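/- arXiv:2308.15305 — 3 statements merged into one kernel-verified Lean document; each statement's English description precedes it below -/
import Mathlib

section
/- Let G = (V,E) be a finite simple graph satisfying the Laman conditions. Then for any two generic edge-length assignments λ, λ′ : E → ℝ_{>0}, the sets of congruence classes of plane realizations of G inducing λ and inducing λ′ are both finite, nonempty, and have the same cardinality. -/
/-- A finite simple graph: vertices are a finite set of naturals, edges are
two-element subsets of the vertex set. -/
structure GeoGraph where
  V : Finset ℕ
  E : Finset (Finset ℕ)
  edge_sub : ∀ e ∈ E, e ⊆ V
  edge_two : ∀ e ∈ E, e.card = 2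

def IsSubgraph (G' G : GeoGraph) : Prop :=
  G'.V ⊆ G.V ∧ G'.E ⊆ G.E

/-- The Laman conditions: `|E| = 2|V| - 3` and every subgraph with at least two
vertices satisfies `|E'| ≤ 2|V'| - 3`. -/
def Laman (G : GeoGraph) : Prop :=
  2 ≤ G.V.card ∧ G.E.card = 2 * G.V.card - 3 ∧
    ∀ G' : GeoGraph, IsSubgraph G' G → 2 ≤ G'.V.card → G'.E.card ≤ 2 * G'.V.card - 3

/-- A generic edge-length assignment: positive real edge lengths that are
algebraically independent over ℚ. -/
def Generic (G : GeoGraph) (lam : Finset ℕ → ℝ) : Prop :=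
  (∀ e ∈ G.E, 0 < lam e) ∧
    AlgebraicIndependent ℚ (fun e : G.E => lam e.1)

/-- A spherical realization: every vertex goes to the complex sphere. -/
def SphereRealization (G : GeoGraph) (ρ : ℕ → Fin 3 → ℂ) : Prop :=
  ∀ v ∈ G.V, ∑ i, ρ v i ^ 2 = 1

/-- A realization induces the edge lengths `lam`. -/
def SphereInduces (G : GeoGraph) (ρ : ℕ → Fin 3 → ℂ) (lam : Finset ℕ → ℝ) : Prop :=
  ∀ u v : ℕ, ({u, v} : Finset ℕ) ∈ G.E →
    ∑ i, (ρ u i - ρ v i) ^ 2 = (lam {u, v} : ℂ)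

/-- Congruence of spherical realizations via `SO₃(ℂ)`. -/
def SphereCongruent (G : GeoGraph) (ρ ρ' : ℕ → Fin 3 → ℂ) : Prop :=
  ∃ A : Matrix (Fin 3) (Fin 3) ℂ, A * A.transpose = 1 ∧ A.det = 1 ∧
    ∀ v ∈ G.V, ρ' v = A.mulVec (ρ v)

/-- Congruence classes of spherical realizations of `G` inducing `lam`. -/
def SphereClasses (G : GeoGraph) (lam : Finset ℕ → ℝ) : Type :=
  Quot fun ρ ρ' : {ρ : ℕ → Fin 3 → ℂ // SphereRealization G ρ ∧ SphereInduces G ρ lam} =>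
    SphereCongruent G ρ.1 ρ'.1

def PlaneInduces (G : GeoGraph) (ρ : ℕ → Fin 2 → ℂ) (lam : Finset ℕ → ℝ) : Prop :=
  ∀ u v : ℕ, ({u, v} : Finset ℕ) ∈ G.E →
    ∑ i, (ρ u i - ρ v i) ^ 2 = (lam {u, v} : ℂ)

/-- Congruence of plane realizations via `SO₂(ℂ)` and a translation. -/
def PlaneCongruent (G : GeoGraph) (ρ ρ' : ℕ → Fin 2 → ℂ) : Prop :=
  ∃ A : Matrix (Fin 2) (Fin 2) ℂ, ∃ b : Fin 2 → ℂ, A * A.transpose = 1 ∧ A.det = 1 ∧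
    ∀ v ∈ G.V, ρ' v = A.mulVec (ρ v) + b

/-- Congruence classes of plane realizations of `G` inducing `lam`. -/
def PlaneClasses (G : GeoGraph) (lam : Finset ℕ → ℝ) : Type :=
  Quot fun ρ ρ' : {ρ : ℕ → Fin 2 → ℂ // PlaneInduces G ρ lam} =>
    PlaneCongruent G ρ.1 ρ'.1

/-- A calligraph: `{0,1,2} ⊆ V`, `{1,2} ∈ E`, `|E| = 2|V| - 4`, and adding the
edge `{0,1}` or the edge `{0,2}` yields a graph satisfying the Laman conditions. -/
def Calligraph (H : GeoGraph) : Prop :=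
  ({0, 1, 2} : Finset ℕ) ⊆ H.V ∧ ({1, 2} : Finset ℕ) ∈ H.E ∧
    H.E.card = 2 * H.V.card - 4 ∧
    ((∃ H' : GeoGraph, H'.V = H.V ∧ H'.E = insert {0, 1} H.E ∧ Laman H') ∨
     (∃ H' : GeoGraph, H'.V = H.V ∧ H'.E = insert {0, 2} H.E ∧ Laman H'))

/-- A split of `G` into two subgraphs sharing exactly the vertices `0,1,2` and
the edge `{1,2}`. -/
def IsSplit (G G₁ G₂ : GeoGraph) : Prop :=
  G.V = G₁.V ∪ G₂.V ∧ G.E = G₁.E ∪ G₂.E ∧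
    G₁.V ∩ G₂.V = ({0, 1, 2} : Finset ℕ) ∧
    G₁.E ∩ G₂.E = ({{1, 2}} : Finset (Finset ℕ))

/-- A calligraphic split: a split into two calligraphs. -/
def CalligraphicSplit (G G₁ G₂ : GeoGraph) : Prop :=
  IsSplit G G₁ G₂ ∧ Calligraph G₁ ∧ Calligraph G₂

theorem exists_ringEquiv_of_isTranscendenceBasis {ι κ : Type*} {x : ι → ℂ} {y : κ → ℂ}
    (hx : IsTranscendenceBasis ℚ x) (hy : IsTranscendenceBasis ℚ y) (e : ι ≃ κ) :
    ∃ σ : ℂ ≃+* ℂ, ∀ i, σ (x i) = y (e i) := by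
  let := IsAlgClosed.isAlgClosure_of_transcendence_basis x hx
  let := IsAlgClosed.isAlgClosure_of_transcendence_basis y hy
  let f : Algebra.adjoin ℚ (Set.range x) ≃+* Algebra.adjoin ℚ (Set.range y) :=
    ((hx.1.aevalEquiv.symm.trans (MvPolynomial.renameEquiv ℚ e)).trans hy.1.aevalEquiv).toRingEquiv
  have hf (i : ι) : f (hx.1.aevalEquiv (MvPolynomial.X i)) =
      hy.1.aevalEquiv (MvPolynomial.X (e i)) := by
    simp [f]
  refine ⟨IsAlgClosure.equivOfEquiv ℂ ℂ f, fun i => ?_⟩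
  have h := IsAlgClosure.equivOfEquiv_algebraMap ℂ ℂ f (hx.1.aevalEquiv (MvPolynomial.X i))
  rw [hf, hx.1.algebraMap_aevalEquiv, hy.1.algebraMap_aevalEquiv] at h
  simpa using h

theorem exists_ringEquiv_of_algebraicIndependent {ι : Type} [Finite ι] {a b : ι → ℂ}
    (ha : AlgebraicIndependent ℚ a) (hb : AlgebraicIndependent ℚ b) :
    ∃ σ : ℂ ≃+* ℂ, ∀ i, σ (a i) = b i := by
  obtain ⟨s, has, hs⟩ := exists_isTranscendenceBasis_superset ha.coe_range
  obtain ⟨t, hbt, ht⟩ := exists_isTranscendenceBasis_superset hb.coe_range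
  have hC : Cardinal.aleph0 < Cardinal.mk ℂ := by
    rw [Cardinal.mk_complex]; exact Cardinal.aleph0_lt_continuum
  have hcard {u : Set ℂ} (hu : IsTranscendenceBasis ℚ ((↑) : u → ℂ)) :
      Cardinal.mk u = Cardinal.mk ℂ := by
    have := IsAlgClosed.cardinal_eq_cardinal_transcendence_basis_of_aleph0_lt _ hu (by simp) hC
    simpa using this.symm
  let a' : ι → s := fun i => ⟨a i, has ⟨i, rfl⟩⟩
  let b' : ι → t := fun i => ⟨b i, hbt ⟨i, rfl⟩⟩
  have ha' : Function.Injective a' := fun i j h => ha.injective (congrArg Subtype.val h)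
  have hb' : Function.Injective b' := fun i j h => hb.injective (congrArg Subtype.val h)
  obtain ⟨g, hg⟩ := Cardinal.extend_function_of_lt
    ((Equiv.ofInjective a' ha').symm.toEmbedding.trans ⟨b', hb'⟩)
    ((Cardinal.lt_aleph0_of_finite _).trans (hC.trans_eq (hcard hs).symm))
    (Cardinal.eq.1 ((hcard hs).trans (hcard ht).symm))
  obtain ⟨σ, hσ⟩ := exists_ringEquiv_of_isTranscendenceBasis hs ht g
  refine ⟨σ, fun i => ?_⟩
  have h := hg ⟨a' i, i, rfl⟩
  have h2 : (Equiv.ofInjective a' ha').symm ⟨a' i, i, rfl⟩ = i :=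
    Equiv.ofInjective_symm_apply ha' i
  have h3 := hσ (a' i)
  simp only [Function.Embedding.trans_apply, Function.Embedding.coeFn_mk,
    h2] at h
  rw [h] at h3
  exact h3

theorem exists_algebraicIndependent_complex (ι : Type) [Countable ι] :
    ∃ z : ι → ℂ, AlgebraicIndependent ℚ z := by
  obtain ⟨s, hs⟩ := exists_isTranscendenceBasis ℚ ℂ
  have hC : Cardinal.aleph0 < Cardinal.mk ℂ := by
    rw [Cardinal.mk_complex]; exact Cardinal.aleph0_lt_continuum
  have h := IsAlgClosed.cardinal_eq_cardinal_transcendence_basis_of_aleph0_lt _ hs (by simp) hC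
  have h' : Cardinal.mk ι ≤ Cardinal.mk s := by
    refine (Cardinal.mk_le_aleph0 (α := ι)).trans (hC.le.trans_eq ?_)
    simpa using h
  obtain ⟨f⟩ := h'
  exact ⟨_, hs.1.comp f f.injective⟩

theorem finite_fiber_of_algebraicIndependent {ι κ : Type} [Finite ι] [Finite κ]
    (hcard : Nat.card ι ≤ Nat.card κ) (F : κ → MvPolynomial ι ℚ) {c : κ → ℂ}
    (hc : AlgebraicIndependent ℚ c) :
    {z : ι → ℂ | ∀ k, MvPolynomial.aeval z (F k) = c k}.Finite := by
  suffices h : ∀ i, ∃ p : Polynomial ℂ, p ≠ 0 ∧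
      ∀ z : ι → ℂ, (∀ k, MvPolynomial.aeval z (F k) = c k) → p.IsRoot (z i) by
    choose p hp hroot using h
    refine (Set.Finite.pi' fun i => (p i).rootSet_finite ℂ).subset fun z hz i => ?_
    rw [Polynomial.mem_rootSet]
    simpa [Polynomial.IsRoot] using ⟨hp i, hroot i z hz⟩
  intro i
  have hdep : ¬ AlgebraicIndependent ℚ (fun o : Option κ => o.elim (MvPolynomial.X i) F) := by
    intro h
    have h1 := h.cardinalMk_le_trdeg
    rw [MvPolynomial.trdeg_of_isDomain] at h1
    have := Fintype.ofFinite ι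
    have := Fintype.ofFinite κ
    simp only [Cardinal.mk_fintype, Fintype.card_option, Nat.card_eq_fintype_card,
      Cardinal.lift_natCast, Nat.cast_le] at h1 hcard
    omega
  rw [algebraicIndependent_iff] at hdep
  push Not at hdep
  obtain ⟨P, hP, hP0⟩ := hdep
  refine ⟨(MvPolynomial.optionEquivLeft ℚ κ P).map
    (MvPolynomial.aeval (R := ℚ) c).toRingHom, ?_, ?_⟩
  · intro h0
    rw [← Polynomial.map_zero (MvPolynomial.aeval (R := ℚ) c).toRingHom] at h0
    have := Polynomial.map_injective (MvPolynomial.aeval (R := ℚ) c).toRingHom hc h0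
    exact hP0 (by simpa using this)
  · intro z hz
    have key : ∀ Q : MvPolynomial (Option κ) ℚ,
        ((MvPolynomial.optionEquivLeft ℚ κ Q).map (MvPolynomial.aeval c).toRingHom).eval (z i) =
        MvPolynomial.aeval z
          (MvPolynomial.aeval (fun o : Option κ => o.elim (MvPolynomial.X i) F) Q) := by
      intro Q
      induction Q using MvPolynomial.induction_on with
      | C a => simp
      | add p q hp hq => simp only [map_add, Polynomial.map_add, Polynomial.eval_add, hp, hq]
      | mul_X p o hp =>
        simp only [map_mul, Polynomial.map_mul, Polynomial.eval_mul, hp]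
        cases o <;> simp [hz]
    rw [Polynomial.IsRoot, key, hP, map_zero]

/-- Every set of at least two vertices spans at most `2k - 3` of the edges in `E`. -/
structure IsSparse (E : Finset (Finset ℕ)) : Prop where
  card_eq_two : ∀ e ∈ E, e.card = 2
  card_spanned_add_le : ∀ W : Finset ℕ, 2 ≤ W.card → (E.filter (· ⊆ W)).card + 3 ≤ 2 * W.card

/-- The plane framework `(x, y)` on the edges `E` has a surjective rigidity map. -/
def IsIndependentAt (E : Finset (Finset ℕ)) (x y : ℕ → ℝ) : Prop :=
  ∀ t : Finset ℕ → ℝ, ∃ m n : ℕ → ℝ, ∀ u v, {u, v} ∈ E →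
    (x u - x v) * (m u - m v) + (y u - y v) * (n u - n v) = t {u, v}

theorem card_filter_subset_add_le (E : Finset (Finset ℕ)) (A B : Finset ℕ) :
    (E.filter (· ⊆ A)).card + (E.filter (· ⊆ B)).card ≤
      (E.filter (· ⊆ A ∪ B)).card + (E.filter (· ⊆ A ∩ B)).card := by
  rw [← Finset.card_union_add_card_inter]
  refine add_le_add (Finset.card_le_card ?_) (Finset.card_le_card ?_)
  · intro e
    simp only [Finset.mem_union, Finset.mem_filter]
    rintro (⟨h, h'⟩ | ⟨h, h'⟩)
    · exact ⟨h, h'.trans Finset.subset_union_left⟩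
    · exact ⟨h, h'.trans Finset.subset_union_right⟩
  · intro e
    simp only [Finset.mem_inter, Finset.mem_filter]
    rintro ⟨⟨h, h'⟩, -, h''⟩
    exact ⟨h, Finset.subset_inter h' h''⟩

namespace IsSparse

variable {E : Finset (Finset ℕ)}

theorem mono (hE : IsSparse E) {E' : Finset (Finset ℕ)} (h : E' ⊆ E) : IsSparse E' :=
  ⟨fun e he => hE.card_eq_two e (h he), fun W hW =>
    (Nat.add_le_add_right (Finset.card_le_card (Finset.filter_subset_filter _ h)) 3).trans
      (hE.card_spanned_add_le W hW)⟩

theorem filter_subset_eq_empty (hE : IsSparse E) {W : Finset ℕ} (hW : W.card ≤ 1) :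
    E.filter (· ⊆ W) = ∅ := by
  refine Finset.filter_eq_empty_iff.2 fun e he h => ?_
  have := Finset.card_le_card h
  have := hE.card_eq_two e he
  omega

/-- The union of two tight sets sharing at least two vertices is tight. -/
theorem tight_union (hE : IsSparse E) {A B : Finset ℕ}
    (hA : 2 * A.card ≤ (E.filter (· ⊆ A)).card + 3)
    (hB : 2 * B.card ≤ (E.filter (· ⊆ B)).card + 3) (hAB : 2 ≤ (A ∩ B).card) :
    2 * (A ∪ B).card ≤ (E.filter (· ⊆ A ∪ B)).card + 3 := by
  have h1 := card_filter_subset_add_le E A B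
  have h2 := hE.card_spanned_add_le (A ∩ B) hAB
  have h3 := Finset.card_union_add_card_inter A B
  omega

/-- If `{a, b}` cannot be added to a sparse edge set then `a` and `b` lie in a tight set. -/
theorem exists_tight_of_not_insert (hE : IsSparse E) {a b : ℕ} (hab : a ≠ b)
    (h : ¬({a, b} ∉ E ∧ IsSparse (insert {a, b} E))) :
    ∃ W : Finset ℕ, a ∈ W ∧ b ∈ W ∧ 2 * W.card ≤ (E.filter (· ⊆ W)).card + 3 := by
  by_cases he : {a, b} ∈ E
  · refine ⟨{a, b}, by simp, by simp, ?_⟩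
    have : 1 ≤ (E.filter (· ⊆ ({a, b} : Finset ℕ))).card :=
      Finset.card_pos.2 ⟨{a, b}, by simp [he]⟩
    rw [Finset.card_pair hab]
    omega
  · by_contra! hcon
    refine h ⟨he, ?_, fun W hW => ?_⟩
    · intro e h'
      rcases Finset.mem_insert.1 h' with rfl | h'
      · exact Finset.card_pair hab
      · exact hE.card_eq_two e h'
    · have h1 := hE.card_spanned_add_le W hW
      rw [Finset.filter_insert]
      split_ifs with hs
      · have h2 := hcon W (hs (by simp)) (hs (by simp))
        have h3 := Finset.card_insert_le ({a, b} : Finset ℕ) (E.filter (· ⊆ W))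
        omega
      · exact h1

/-- Tight sets through the three pairs of `{a, b, c}` merge to one containing `{a, b, c}`. -/
theorem exists_tight_triple (hE : IsSparse E) {a b c : ℕ} {A B C : Finset ℕ}
    (hca : c ≠ a)
    (hA : 2 * A.card ≤ (E.filter (· ⊆ A)).card + 3)
    (hB : 2 * B.card ≤ (E.filter (· ⊆ B)).card + 3)
    (hC : 2 * C.card ≤ (E.filter (· ⊆ C)).card + 3)
    (haA : a ∈ A) (hbA : b ∈ A) (hbB : b ∈ B) (hcB : c ∈ B) (hcC : c ∈ C) (haC : a ∈ C) :
    ∃ W : Finset ℕ, a ∈ W ∧ b ∈ W ∧ c ∈ W ∧ 2 * W.card ≤ (E.filter (· ⊆ W)).card + 3 := by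
  by_cases h1 : 2 ≤ (A ∩ B).card
  · exact ⟨A ∪ B, by simp [haA], by simp [hbA], by simp [hcB], hE.tight_union hA hB h1⟩
  by_cases h2 : 2 ≤ (A ∩ C).card
  · exact ⟨A ∪ C, by simp [haA], by simp [hbA], by simp [hcC], hE.tight_union hA hC h2⟩
  by_cases h3 : 2 ≤ (B ∩ C).card
  · exact ⟨B ∪ C, by simp [haC], by simp [hbB], by simp [hcB], hE.tight_union hB hC h3⟩
  refine ⟨A ∪ B ∪ C, by simp [haA], by simp [hbA], by simp [hcB], ?_⟩
  have hABC : 2 ≤ ((A ∪ B) ∩ C).card := by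
    rw [← Finset.card_pair hca]
    refine Finset.card_le_card fun w hw => ?_
    rcases Finset.mem_insert.1 hw with rfl | hw
    · simp [hcB, hcC]
    · rw [Finset.mem_singleton.1 hw]
      simp [haA, haC]
  have hd : Disjoint (E.filter (· ⊆ A) ∪ E.filter (· ⊆ B)) (E.filter (· ⊆ C)) := by
    rw [Finset.disjoint_left]
    intro e he heC
    simp only [Finset.mem_union, Finset.mem_filter] at he heC
    have hcard := hE.card_eq_two e heC.1
    rcases he with he | he
    · have := Finset.card_le_card (Finset.subset_inter he.2 heC.2)
      omega
    · have := Finset.card_le_card (Finset.subset_inter he.2 heC.2)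
      omega
  have hd' : Disjoint (E.filter (· ⊆ A)) (E.filter (· ⊆ B)) := by
    rw [Finset.disjoint_left]
    intro e he heB
    simp only [Finset.mem_filter] at he heB
    have hcard := hE.card_eq_two e heB.1
    have := Finset.card_le_card (Finset.subset_inter he.2 heB.2)
    omega
  have hsub : (E.filter (· ⊆ A) ∪ E.filter (· ⊆ B)) ∪ E.filter (· ⊆ C) ⊆
      E.filter (· ⊆ A ∪ B ∪ C) := by
    intro e
    simp only [Finset.mem_union, Finset.mem_filter]
    rintro ((⟨h, h'⟩ | ⟨h, h'⟩) | ⟨h, h'⟩)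
    · exact ⟨h, h'.trans (Finset.subset_union_left.trans Finset.subset_union_left)⟩
    · exact ⟨h, h'.trans (Finset.subset_union_right.trans Finset.subset_union_left)⟩
    · exact ⟨h, h'.trans Finset.subset_union_right⟩
  have h4 := Finset.card_le_card hsub
  rw [Finset.card_union_of_disjoint hd, Finset.card_union_of_disjoint hd'] at h4
  have h5 := Finset.card_union_add_card_inter A B
  have h6 := Finset.card_union_add_card_inter (A ∪ B) C
  have h7 : 1 ≤ (A ∩ B).card := Finset.card_pos.2 ⟨b, by simp [hbA, hbB]⟩
  omega

/-- Deleting a vertex with neighbours `a, b, c` leaves room for one of the edges of the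
triangle `a, b, c`. -/
theorem exists_insert (hE : IsSparse E) {v a b c : ℕ} (hab : a ≠ b) (hbc : b ≠ c) (hca : c ≠ a)
    (hva : {v, a} ∈ E) (hvb : {v, b} ∈ E) (hvc : {v, c} ∈ E) :
    ({a, b} ∉ E ∧ IsSparse (insert {a, b} (E.filter (v ∉ ·)))) ∨
    ({b, c} ∉ E ∧ IsSparse (insert {b, c} (E.filter (v ∉ ·)))) ∨
    ({c, a} ∉ E ∧ IsSparse (insert {c, a} (E.filter (v ∉ ·)))) := by
  have hne {w : ℕ} (hw : {v, w} ∈ E) : v ≠ w := by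
    rintro rfl
    simpa using hE.card_eq_two _ hw
  have hva' := hne hva
  have hvb' := hne hvb
  have hvc' := hne hvc
  set E' := E.filter (v ∉ ·) with hE'def
  have hE' : IsSparse E' := hE.mono (Finset.filter_subset _ _)
  have hmem {p q : ℕ} (hp : v ≠ p) (hq : v ≠ q) : {p, q} ∉ E ↔ {p, q} ∉ E' := by
    simp [hE'def, hp, hq]
  rw [hmem hva' hvb', hmem hvb' hvc', hmem hvc' hva']
  by_contra! hcon
  obtain ⟨A, haA, hbA, hA⟩ := hE'.exists_tight_of_not_insert hab (fun h => hcon.1 h.1 h.2)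
  obtain ⟨B, hbB, hcB, hB⟩ := hE'.exists_tight_of_not_insert hbc (fun h => hcon.2.1 h.1 h.2)
  obtain ⟨C, hcC, haC, hC⟩ := hE'.exists_tight_of_not_insert hca (fun h => hcon.2.2 h.1 h.2)
  obtain ⟨W, ha, hb, hc, hW⟩ :=
    hE'.exists_tight_triple hca hA hB hC haA hbA hbB hcB hcC haC
  have hsub : E'.filter (· ⊆ W) ∪ {{v, a}, {v, b}, {v, c}} ⊆ E.filter (· ⊆ insert v W) := by
    intro e he
    simp only [Finset.mem_union, Finset.mem_insert, Finset.mem_singleton, hE'def,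
      Finset.mem_filter] at he ⊢
    rcases he with ⟨⟨h, -⟩, h'⟩ | rfl | rfl | rfl
    · exact ⟨h, h'.trans (Finset.subset_insert _ _)⟩
    · exact ⟨hva, Finset.insert_subset_insert _ (by simpa)⟩
    · exact ⟨hvb, Finset.insert_subset_insert _ (by simpa)⟩
    · exact ⟨hvc, Finset.insert_subset_insert _ (by simpa)⟩
  have hdis : Disjoint (E'.filter (· ⊆ W)) {{v, a}, {v, b}, {v, c}} := by
    rw [Finset.disjoint_left]
    intro e he he'
    simp only [hE'def, Finset.mem_filter] at he
    simp only [Finset.mem_insert, Finset.mem_singleton] at he'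
    rcases he' with rfl | rfl | rfl <;> simp at he
  have hpair {p q : ℕ} (hp : v ≠ p) (hpq : p ≠ q) : ({v, p} : Finset ℕ) ≠ {v, q} := by
    intro h
    have : p ∈ ({v, q} : Finset ℕ) := h ▸ (by simp)
    simp only [Finset.mem_insert, Finset.mem_singleton] at this
    tauto
  have h3 : ({{v, a}, {v, b}, {v, c}} : Finset (Finset ℕ)).card = 3 :=
    Finset.card_eq_three.2 ⟨_, _, _, hpair hva' hab, hpair hva' hca.symm, hpair hvb' hbc, rfl⟩
  have h4 := Finset.card_le_card hsub
  rw [Finset.card_union_of_disjoint hdis, h3] at h4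
  have h5 := Finset.card_insert_le v W
  have h6 : 2 ≤ W.card := by
    rw [← Finset.card_pair hab]
    exact Finset.card_le_card (Finset.insert_subset ha (by simpa))
  have h7 := hE.card_spanned_add_le (insert v W)
    (h6.trans (Finset.card_le_card (Finset.subset_insert _ _)))
  omega

/-- A sparse edge set has a vertex of degree at most three. -/
theorem exists_card_filter_mem_le (hE : IsSparse E) {V : Finset ℕ} (hV : V.Nonempty)
    (hEV : ∀ e ∈ E, e ⊆ V) : ∃ v ∈ V, (E.filter (v ∈ ·)).card ≤ 3 := by
  by_contra! hcon
  have h1 : ∑ v ∈ V, (E.filter (v ∈ ·)).card = ∑ e ∈ E, (V.filter (· ∈ e)).card :=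
    Finset.sum_card_bipartiteAbove_eq_sum_card_bipartiteBelow (fun (v : ℕ) (e : Finset ℕ) => v ∈ e)
  have h2 : ∑ e ∈ E, (V.filter (· ∈ e)).card = E.card * 2 := by
    refine Finset.sum_const_nat fun e he => ?_
    rw [Finset.filter_mem_eq_inter, Finset.inter_eq_right.2 (hEV e he), hE.card_eq_two e he]
  have h3 : V.card * 4 ≤ ∑ v ∈ V, (E.filter (v ∈ ·)).card :=
    Finset.card_nsmul_le_sum V _ 4 fun v hv => hcon v hv
  have h4 : E.filter (· ⊆ V) = E := Finset.filter_true_of_mem hEV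
  have h5 := hV.card_pos
  by_cases hV2 : 2 ≤ V.card
  · have := hE.card_spanned_add_le V hV2
    rw [h4] at this
    omega
  · have := hE.filter_subset_eq_empty (W := V) (by omega)
    rw [h4] at this
    exact hV.ne_empty (by simpa [this] using h3)

end IsSparse

theorem exists_endpoints {E : Finset (Finset ℕ)} (hE : ∀ e ∈ E, e.card = 2) :
    ∃ s t : E → ℕ, ∀ e : E, (e : Finset ℕ) = {s e, t e} ∧ s e ≠ t e := by
  have h (e : E) : ∃ p : ℕ × ℕ, (e : Finset ℕ) = {p.1, p.2} ∧ p.1 ≠ p.2 := by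
    obtain ⟨a, b, hab, he⟩ := Finset.card_eq_two.1 (hE e e.2)
    exact ⟨(a, b), he, hab⟩
  choose p hp using h
  exact ⟨fun e => (p e).1, fun e => (p e).2, hp⟩

/-- Two pairs of endpoints of the same edge agree up to a swap. -/
theorem eq_or_swap_of_pair_eq {u v a b : ℕ} (h : ({u, v} : Finset ℕ) = {a, b}) :
    (u = a ∧ v = b) ∨ (u = b ∧ v = a) := by
  have := congrArg (fun s : Finset ℕ => (s : Set ℕ)) h
  simpa [Set.pair_eq_pair_iff] using this

namespace IsIndependentAt

open Filter Topology

variable {E : Finset (Finset ℕ)} {x y : ℕ → ℝ}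

/-- Independence at a framework persists under small perturbations along a line. -/
theorem eventually_add_smul (hE : ∀ e ∈ E, e.card = 2) (h : IsIndependentAt E x y)
    (x' y' : ℕ → ℝ) :
    ∀ᶠ r : ℝ in 𝓝 0, IsIndependentAt E (x + r • x') (y + r • y') := by
  classical
  obtain ⟨s, t, hst⟩ := exists_endpoints hE
  choose m n hmn using fun e : E => h (Pi.single (e : Finset ℕ) 1)
  let M : ℝ → Matrix E E ℝ := fun r => Matrix.of fun e e' =>
    ((x + r • x') (s e) - (x + r • x') (t e)) * (m e' (s e) - m e' (t e)) +
    ((y + r • y') (s e) - (y + r • y') (t e)) * (n e' (s e) - n e' (t e))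
  have hM0 : M 0 = 1 := by
    ext e e'
    have h1 := hmn e' (s e) (t e) (by rw [← (hst e).1]; exact e.2)
    rw [← (hst e).1] at h1
    simp only [M, Matrix.of_apply, zero_smul, add_zero, h1, Matrix.one_apply, Pi.single_apply,
      Subtype.ext_iff]
  have hcont : Continuous fun r => (M r).det := by
    refine Continuous.matrix_det (continuous_matrix fun e e' => ?_)
    simp only [M, Matrix.of_apply, Pi.add_apply, Pi.smul_apply]
    fun_prop
  have hdet : ∀ᶠ r in 𝓝 (0 : ℝ), (M r).det ≠ 0 :=
    hcont.continuousAt.eventually_ne (by simp [hM0])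
  filter_upwards [hdet] with r hr T
  let w : E → ℝ := (M r)⁻¹.mulVec fun e => T e
  have hw : (M r).mulVec w = fun e : E => T e := by
    rw [Matrix.mulVec_mulVec, Matrix.mul_nonsing_inv _ (isUnit_iff_ne_zero.2 hr),
      Matrix.one_mulVec]
  refine ⟨fun u => ∑ e', w e' * m e' u, fun u => ∑ e', w e' * n e' u, fun u v huv => ?_⟩
  have key : ∀ e : E, ((x + r • x') (s e) - (x + r • x') (t e)) *
      (∑ e', w e' * m e' (s e) - ∑ e', w e' * m e' (t e)) +
      ((y + r • y') (s e) - (y + r • y') (t e)) *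
      (∑ e', w e' * n e' (s e) - ∑ e', w e' * n e' (t e)) = T e := by
    intro e
    have h1 := congrFun hw e
    simp only [Matrix.mulVec, dotProduct] at h1
    rw [← h1, ← Finset.sum_sub_distrib, ← Finset.sum_sub_distrib, Finset.mul_sum, Finset.mul_sum,
      ← Finset.sum_add_distrib]
    refine Finset.sum_congr rfl fun e' _ => ?_
    simp only [M, Matrix.of_apply]
    ring
  have h2 := key ⟨{u, v}, huv⟩
  rcases eq_or_swap_of_pair_eq (hst ⟨{u, v}, huv⟩).1 with ⟨h3, h4⟩ | ⟨h3, h4⟩ <;>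
    rw [← h3, ← h4] at h2 <;> linear_combination h2

/-- The framework of an independent edge set can be perturbed so that three given points are
not collinear. -/
theorem exists_not_collinear (hE : ∀ e ∈ E, e.card = 2) (h : IsIndependentAt E x y)
    {a b c : ℕ} (hab : a ≠ b) (hbc : b ≠ c) (hca : c ≠ a) :
    ∃ x' y' : ℕ → ℝ, IsIndependentAt E x' y' ∧
      (x' b - x' a) * (y' c - y' a) - (y' b - y' a) * (x' c - x' a) ≠ 0 := by
  let p : Polynomial ℝ :=
    (Polynomial.C (x b - x a) + Polynomial.X) * (Polynomial.C (y c - y a) + Polynomial.X) -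
      Polynomial.C ((y b - y a) * (x c - x a))
  have hp : p ≠ 0 := by
    intro h0
    have h1 (r : ℝ) : (x b - x a + r) * (y c - y a + r) - (y b - y a) * (x c - x a) = 0 := by
      simpa [p] using congrArg (Polynomial.eval r) h0
    linarith [h1 0, h1 1, h1 (-1)]
  have h1 : ∀ᶠ r in 𝓝[≠] (0 : ℝ), p.eval r ≠ 0 := by
    have : ∀ᶠ r in cofinite, p.eval r ≠ 0 := by
      simpa [eventually_cofinite] using p.finite_setOfPred_isRoot hp
    exact this.filter_mono (nhdsNE_le_cofinite 0)
  obtain ⟨r, h2, h3⟩ := (((h.eventually_add_smul hE (Pi.single b 1) (Pi.single c 1)).filter_mono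
    nhdsWithin_le_nhds).and h1).exists
  refine ⟨_, _, h2, ?_⟩
  convert h3 using 1
  simp [p, hab, hbc, hbc.symm, hca.symm]
  ring

end IsIndependentAt

/-- A vertex joined to at most two non-collinear directions can be added. -/
theorem IsIndependentAt.of_two_neighbours {E : Finset (Finset ℕ)} {v a b : ℕ} {x y : ℕ → ℝ}
    (hva : v ≠ a) (hvb : v ≠ b)
    (hN : ∀ w, {v, w} ∈ E → w = a ∨ w = b)
    (h : IsIndependentAt (E.filter (v ∉ ·)) x y)
    (hxy : (x v - x a) * (y v - y b) - (y v - y a) * (x v - x b) ≠ 0) :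
    IsIndependentAt E x y := by
  intro t
  obtain ⟨m, n, hmn⟩ := h t
  set D := (x v - x a) * (y v - y b) - (y v - y a) * (x v - x b) with hD
  let p := t {v, a} + (x v - x a) * m a + (y v - y a) * n a
  let q := t {v, b} + (x v - x b) * m b + (y v - y b) * n b
  let m' := Function.update m v ((p * (y v - y b) - q * (y v - y a)) / D)
  let n' := Function.update n v ((q * (x v - x a) - p * (x v - x b)) / D)
  have key : ∀ w, {v, w} ∈ E →
      (x v - x w) * (m' v - m' w) + (y v - y w) * (n' v - n' w) = t {v, w} := by
    intro w hw
    rcases hN w hw with rfl | rfl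
    · simp only [m', n', Function.update_self, Function.update_of_ne hva.symm, p, q]
      field_simp
      rw [hD]
      ring
    · simp only [m', n', Function.update_self, Function.update_of_ne hvb.symm, p, q]
      field_simp
      rw [hD]
      ring
  refine ⟨m', n', fun u w huw => ?_⟩
  by_cases hu : u = v
  · subst hu
    exact key w huw
  by_cases hw : w = v
  · subst hw
    rw [Finset.pair_comm] at huw ⊢
    rw [← key u huw]
    ring
  · simp only [m', n', Function.update_of_ne hu, Function.update_of_ne hw]
    exact hmn u w (by simp [huw, Ne.symm hu, Ne.symm hw])

/-- Subdividing an edge `{a, b}` by a new vertex `v`, also joined to `c`, keeps independence. -/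
theorem IsIndependentAt.exists_of_three_neighbours {E : Finset (Finset ℕ)} {v a b c : ℕ}
    {x y : ℕ → ℝ} (hE : ∀ e ∈ E, e.card = 2) (hab : a ≠ b) (hbc : b ≠ c) (hca : c ≠ a)
    (hva : v ≠ a) (hvb : v ≠ b) (hvc : v ≠ c)
    (hN : ∀ w, {v, w} ∈ E → w = a ∨ w = b ∨ w = c) (hE' : {a, b} ∉ E)
    (h : IsIndependentAt (insert {a, b} (E.filter (v ∉ ·))) x y) :
    ∃ x' y' : ℕ → ℝ, IsIndependentAt E x' y' := by
  have hcard : ∀ e ∈ insert {a, b} (E.filter (v ∉ ·)), e.card = 2 := by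
    intro e he
    rcases Finset.mem_insert.1 he with rfl | he
    · exact Finset.card_pair hab
    · exact hE e (Finset.mem_filter.1 he).1
  obtain ⟨x, y, h, hD0⟩ := h.exists_not_collinear hcard hab hbc hca
  let x' := Function.update x v ((x a + x b) / 2)
  let y' := Function.update y v ((y a + y b) / 2)
  refine ⟨x', y', fun t => ?_⟩
  obtain ⟨m, n, hmn⟩ := h (Function.update t {a, b} (2 * (t {v, a} + t {v, b})))
  have hmnab := hmn a b (Finset.mem_insert_self _ _)
  rw [Function.update_self] at hmnab
  let dx := (x a - x b) / 2
  let dy := (y a - y b) / 2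
  let ex := (x a + x b) / 2 - x c
  let ey := (y a + y b) / 2 - y c
  let D := dx * ey - dy * ex
  have hD : D ≠ 0 := by
    have : D = (1 / 2) * ((x b - x a) * (y c - y a) - (y b - y a) * (x c - x a)) := by
      simp only [D, dx, dy, ex, ey]
      ring
    rw [this]
    exact mul_ne_zero (by norm_num) hD0
  let p := t {v, b} + dx * m b + dy * n b
  let q := t {v, c} + ex * m c + ey * n c
  let mv := (p * ey - q * dy) / D
  let nv := (q * dx - p * ex) / D
  have h1 : dx * mv + dy * nv = p := by
    simp only [mv, nv]
    field_simp
    simp only [D]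
    ring
  have h2 : ex * mv + ey * nv = q := by
    simp only [mv, nv]
    field_simp
    simp only [D]
    ring
  have key : ∀ w, {v, w} ∈ E →
      (x' v - x' w) * (Function.update m v mv v - Function.update m v mv w) +
      (y' v - y' w) * (Function.update n v nv v - Function.update n v nv w) = t {v, w} := by
    intro w hw
    simp only [x', y']
    rcases hN w hw with rfl | rfl | rfl
    · simp only [Function.update_self, Function.update_of_ne hva.symm]
      simp only [dx, dy, p] at h1
      linear_combination (1 / 2) * hmnab - h1
    · simp only [Function.update_self, Function.update_of_ne hvb.symm]
      simp only [dx, dy, p] at h1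
      linear_combination h1
    · simp only [Function.update_self, Function.update_of_ne hvc.symm]
      simp only [ex, ey, q] at h2
      linear_combination h2
  refine ⟨Function.update m v mv, Function.update n v nv, fun u w huw => ?_⟩
  by_cases hu : u = v
  · subst hu
    exact key w huw
  by_cases hw : w = v
  · subst hw
    rw [Finset.pair_comm] at huw ⊢
    rw [← key u huw]
    ring
  · simp only [x', y', Function.update_of_ne hu, Function.update_of_ne hw]
    rw [hmn u w (by simp [huw, Ne.symm hu, Ne.symm hw]), Function.update_of_ne]
    intro h0
    exact hE' (h0 ▸ huw)

/-- The edges at `v` are counted by the neighbours of `v`. -/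
theorem card_filter_mem_eq_card_neighbours {E : Finset (Finset ℕ)} (hE : ∀ e ∈ E, e.card = 2)
    {V : Finset ℕ} (hEV : ∀ e ∈ E, e ⊆ V) (v : ℕ) :
    (V.filter fun w => {v, w} ∈ E).card = (E.filter (v ∈ ·)).card := by
  refine Finset.card_bij (fun w _ => {v, w}) ?_ ?_ ?_
  · intro w hw
    simpa using (Finset.mem_filter.1 hw).2
  · intro w hw w' _ h
    rcases eq_or_swap_of_pair_eq h with h | h
    · exact h.2
    · exact h.2.trans h.1
  · intro e he
    obtain ⟨he, hv⟩ := Finset.mem_filter.1 he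
    obtain ⟨a, b, hab, rfl⟩ := Finset.card_eq_two.1 (hE e he)
    rcases Finset.mem_insert.1 hv with rfl | hv
    · exact ⟨b, by simpa [he] using hEV _ he (by simp), rfl⟩
    · rw [Finset.mem_singleton] at hv
      subst hv
      rw [Finset.pair_comm] at he ⊢
      exact ⟨a, by simpa [he] using hEV _ he (by simp), rfl⟩

/-- The sufficiency part of the Geiringer–Laman theorem. -/
theorem IsSparse.exists_isIndependentAt (V : Finset ℕ) :
    ∀ E : Finset (Finset ℕ), IsSparse E → (∀ e ∈ E, e ⊆ V) → ∃ x y, IsIndependentAt E x y := by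
  induction V using Finset.strongInduction with
  | H V ih =>
  intro E hE hEV
  rcases V.eq_empty_or_nonempty with rfl | hV
  · refine ⟨0, 0, fun t => ⟨0, 0, fun u v huv => ?_⟩⟩
    simpa using hEV _ huv (Finset.mem_insert_self u _)
  obtain ⟨v, hv, hdeg⟩ := hE.exists_card_filter_mem_le hV hEV
  have hE' : IsSparse (E.filter (v ∉ ·)) := hE.mono (Finset.filter_subset _ _)
  have hEV' : ∀ e ∈ E.filter (v ∉ ·), e ⊆ V.erase v := fun e he =>
    Finset.subset_erase.2 ⟨hEV e (Finset.mem_filter.1 he).1, (Finset.mem_filter.1 he).2⟩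
  rw [← card_filter_mem_eq_card_neighbours hE.card_eq_two hEV v] at hdeg
  set N := V.filter fun w => {v, w} ∈ E with hNdef
  have hmemN {w : ℕ} : w ∈ N ↔ {v, w} ∈ E := by
    simp only [hNdef, Finset.mem_filter, and_iff_right_iff_imp]
    exact fun h => hEV _ h (by simp)
  have hvN : v ∉ N := fun h => by simpa using hE.card_eq_two _ (hmemN.1 h)
  rcases hdeg.lt_or_eq with hlt | heq
  · obtain ⟨x, y, hxy⟩ := ih _ (Finset.erase_ssubset hv) _ hE' hEV'
    obtain ⟨N', hNN', hN'⟩ := Infinite.exists_superset_card_eq (insert v N) 3 (by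
      rw [Finset.card_insert_of_notMem hvN]; omega)
    have hvN' : v ∈ N' := hNN' (Finset.mem_insert_self _ _)
    obtain ⟨a, b, hab, hN2⟩ := Finset.card_eq_two.1 (show (N'.erase v).card = 2 by
      rw [Finset.card_erase_of_mem hvN', hN'])
    have ha : v ≠ a := fun h => by simpa [h] using hN2.ge (Finset.mem_insert_self a _)
    have hb : v ≠ b := fun h => by
      simpa [h] using hN2.ge (Finset.mem_insert_of_mem (Finset.mem_singleton_self b))
    obtain ⟨x', y', hxy', hD⟩ := hxy.exists_not_collinear hE'.card_eq_two ha hab hb.symm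
    refine ⟨x', y', hxy'.of_two_neighbours ha hb (fun w hw => ?_) ?_⟩
    · have h1 : w ∈ N'.erase v :=
        Finset.mem_erase.2 ⟨fun h => hvN (h ▸ hmemN.2 hw),
          hNN' (Finset.mem_insert_of_mem (hmemN.2 hw))⟩
      simpa [hN2] using h1
    · convert hD using 1
      ring
  · obtain ⟨a, b, c, hab, hac, hbc, hN⟩ := Finset.card_eq_three.1 heq
    have hva : {v, a} ∈ E := hmemN.1 (by simp [hN])
    have hvb : {v, b} ∈ E := hmemN.1 (by simp [hN])
    have hvc : {v, c} ∈ E := hmemN.1 (by simp [hN])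
    have hne {w : ℕ} (hw : {v, w} ∈ E) : v ≠ w := fun h => hvN (h ▸ hmemN.2 hw)
    have hmemV {w : ℕ} (hw : {v, w} ∈ E) : w ∈ V.erase v :=
      Finset.mem_erase.2 ⟨(hne hw).symm, hEV _ hw (by simp)⟩
    have hNabc (w : ℕ) (hw : {v, w} ∈ E) : w = a ∨ w = b ∨ w = c := by
      simpa [hN] using hmemN.2 hw
    have of_insert {a b c : ℕ} (hab : a ≠ b) (hbc : b ≠ c) (hca : c ≠ a)
        (hva : {v, a} ∈ E) (hvb : {v, b} ∈ E) (hvc : {v, c} ∈ E)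
        (hNabc : ∀ w, {v, w} ∈ E → w = a ∨ w = b ∨ w = c)
        (h : {a, b} ∉ E ∧ IsSparse (insert {a, b} (E.filter (v ∉ ·)))) :
        ∃ x y, IsIndependentAt E x y := by
      obtain ⟨x, y, hxy⟩ := ih _ (Finset.erase_ssubset hv) _ h.2 (by
        intro e he
        rcases Finset.mem_insert.1 he with rfl | he
        · exact Finset.insert_subset (hmemV hva) (Finset.singleton_subset_iff.2 (hmemV hvb))
        · exact hEV' e he)
      exact hxy.exists_of_three_neighbours hE.card_eq_two hab hbc hca (hne hva) (hne hvb)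
        (hne hvc) hNabc h.1
    rcases hE.exists_insert hab hbc hac.symm hva hvb hvc with h | h | h
    · exact of_insert hab hbc hac.symm hva hvb hvc hNabc h
    · exact of_insert hbc hac.symm hab hvb hvc hva (fun w hw => by have := hNabc w hw; tauto) h
    · exact of_insert hac.symm hab hbc hvc hva hvb (fun w hw => by have := hNabc w hw; tauto) h

/-- A graph satisfying the Laman conditions has a sparse edge set. -/
theorem Laman.isSparse {G : GeoGraph} (hG : Laman G) : IsSparse G.E := by
  refine ⟨G.edge_two, fun W hW => ?_⟩
  let G' : GeoGraph :=
    { V := W ∩ G.V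
      E := G.E.filter (· ⊆ W)
      edge_sub := fun e he =>
        Finset.subset_inter (Finset.mem_filter.1 he).2 (G.edge_sub e (Finset.mem_filter.1 he).1)
      edge_two := fun e he => G.edge_two e (Finset.mem_filter.1 he).1 }
  have hWV : (W ∩ G.V).card ≤ W.card := Finset.card_le_card Finset.inter_subset_left
  by_cases h2 : 2 ≤ (W ∩ G.V).card
  · have h3 := hG.2.2 G' ⟨Finset.inter_subset_right, Finset.filter_subset _ _⟩ h2
    change (G.E.filter (· ⊆ W)).card ≤ 2 * (W ∩ G.V).card - 3 at h3
    omega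
  · have h3 : G.E.filter (· ⊆ W) = ∅ := by
      refine Finset.eq_empty_of_forall_notMem fun e he => h2 ?_
      rw [← G'.edge_two e he]
      exact Finset.card_le_card (G'.edge_sub e he)
    rw [h3, Finset.card_empty]
    omega

open MvPolynomial in
/-- The squared edge lengths of an independent edge set are algebraically independent. -/
theorem IsIndependentAt.algebraicIndependent {E : Finset (Finset ℕ)} {x y : ℕ → ℝ}
    (h : IsIndependentAt E x y) {s t : E → ℕ} (hst : ∀ e : E, (e : Finset ℕ) = {s e, t e}) :
    AlgebraicIndependent ℚ fun e : E =>
      ∑ i : Fin 2, (X (s e, i) - X (t e, i) : MvPolynomial (ℕ × Fin 2) ℚ) ^ 2 := by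
  classical
  choose m n hmn using fun e : E => h (Pi.single (e : Finset ℕ) 1)
  let P : (E → ℝ) → ℕ × Fin 2 → ℝ := fun w p =>
    ![x p.1 + ∑ e', w e' * m e' p.1, y p.1 + ∑ e', w e' * n e' p.1] p.2
  let g : (E → ℝ) → E → ℝ := fun w e =>
    ∑ i : Fin 2, (P w (s e, i) - P w (t e, i)) ^ 2
  let L : (E → ℕ → ℝ) → E → (E → ℝ) →L[ℝ] ℝ := fun k e =>
    ∑ e', (k e' (s e) - k e' (t e)) • ContinuousLinearMap.proj e'
  let g' : (E → ℝ) →L[ℝ] E → ℝ := (2 : ℝ) • ContinuousLinearMap.id ℝ (E → ℝ)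
  have hL (k : E → ℕ → ℝ) (c : ℕ → ℝ) (e : E) : HasStrictFDerivAt
      (fun w : E → ℝ => (c (s e) + ∑ e', w e' * k e' (s e)) -
        (c (t e) + ∑ e', w e' * k e' (t e))) (L k e) 0 := by
    have h1 := ((L k e).hasStrictFDerivAt (x := 0)).const_add (c (s e) - c (t e))
    refine h1.congr_of_eventuallyEq (Filter.Eventually.of_forall fun w => ?_)
    have h2 : L k e w = ∑ e', w e' * k e' (s e) - ∑ e', w e' * k e' (t e) := by
      rw [← Finset.sum_sub_distrib]
      simp only [L, sum_apply, smul_apply, ContinuousLinearMap.proj_apply,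
        smul_eq_mul]
      exact Finset.sum_congr rfl fun _ _ => by ring
    change c (s e) - c (t e) + L k e w = _
    rw [h2]
    ring
  have hg : HasStrictFDerivAt g g' 0 := by
    refine hasStrictFDerivAt_pi'.2 fun e => ?_
    have h1 := ((hL m x e).pow 2).add ((hL n y e).pow 2)
    have h2 : (fun w => g w e) = fun w : E → ℝ =>
        ((x (s e) + ∑ e', w e' * m e' (s e)) - (x (t e) + ∑ e', w e' * m e' (t e))) ^ 2 +
        ((y (s e) + ∑ e', w e' * n e' (s e)) - (y (t e) + ∑ e', w e' * n e' (t e))) ^ 2 := by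
      ext w
      simp [g, P, Fin.sum_univ_two]
    rw [h2]
    refine h1.congr_fderiv ?_
    ext w
    have h3 : ∀ e', w e' * ((x (s e) - x (t e)) * (m e' (s e) - m e' (t e)) +
        (y (s e) - y (t e)) * (n e' (s e) - n e' (t e))) = if e = e' then w e' else 0 := by
      intro e'
      have h4 := hmn e' (s e) (t e) (by rw [← hst e]; exact e.2)
      rw [← hst e, Pi.single_apply] at h4
      simp only [h4, Subtype.coe_inj, mul_ite, mul_one, mul_zero]
    have h5 := Finset.sum_congr (rfl : (Finset.univ : Finset E) = Finset.univ) fun e' _ => h3 e'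
    rw [Finset.sum_ite_eq, if_pos (Finset.mem_univ _)] at h5
    simp [L, g', ← h5, Finset.mul_sum, ← Finset.sum_add_distrib]
    exact Finset.sum_congr rfl fun e' _ => by ring
  have hrange : g'.range = ⊤ := by
    refine LinearMap.range_eq_top.2 fun v => ⟨(2⁻¹ : ℝ) • v, ?_⟩
    simp [g']
  have himage : Set.range g ∈ nhds (g 0) := by
    rw [← hg.map_nhds_eq_of_surj hrange]
    exact Filter.range_mem_map
  obtain ⟨δ, hδ, hball⟩ := Metric.mem_nhds_iff.1 himage
  rw [algebraicIndependent_iff]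
  intro p hp
  have hq : map (algebraMap ℚ ℝ) p = 0 := by
    refine funext_set (fun e => Metric.ball (g 0 e) δ) (fun e => ?_) fun v hv => ?_
    · rw [Real.ball_eq_Ioo]
      exact Set.Ioo_infinite (by linarith)
    · obtain ⟨w, rfl⟩ := hball (by rwa [← ball_pi _ hδ] at hv)
      have h1 := congrArg (aeval (P w)) hp
      rw [← AlgHom.comp_apply, comp_aeval, map_zero] at h1
      rw [eval_map, ← aeval_def, map_zero, ← h1]
      congr 2
      ext e
      simp [g]
  exact map_injective _ (algebraMap ℚ ℝ).injective (by rw [hq, map_zero])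

theorem Generic.algebraicIndependent_complex {G : GeoGraph} {lam : Finset ℕ → ℝ}
    (h : Generic G lam) : AlgebraicIndependent ℚ fun e : G.E => (lam e : ℂ) :=
  h.2.map' (f := (Algebra.ofId ℝ ℂ).restrictScalars ℚ) Complex.ofReal_injective

/-- It suffices to check the induced lengths for one ordering of the endpoints of each edge. -/
theorem planeInduces_of_endpoints {G : GeoGraph} {ρ : ℕ → Fin 2 → ℂ} {lam : Finset ℕ → ℝ}
    {s t : G.E → ℕ} (hst : ∀ e : G.E, (e : Finset ℕ) = {s e, t e})
    (h : ∀ e : G.E, ∑ i, (ρ (s e) i - ρ (t e) i) ^ 2 = (lam e : ℂ)) : PlaneInduces G ρ lam := by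
  intro u v huv
  have h1 := h ⟨_, huv⟩
  rcases eq_or_swap_of_pair_eq (hst ⟨_, huv⟩) with ⟨h2, h3⟩ | ⟨h2, h3⟩
  · rwa [← h2, ← h3] at h1
  · rw [← h2, ← h3] at h1
    rw [← h1]
    exact Finset.sum_congr rfl fun i _ => by ring

theorem Laman.nonempty_planeClasses {G : GeoGraph} (hG : Laman G) {lam : Finset ℕ → ℝ}
    (hlam : Generic G lam) : Nonempty (PlaneClasses G lam) := by
  obtain ⟨x, y, hxy⟩ := IsSparse.exists_isIndependentAt G.V G.E hG.isSparse G.edge_sub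
  obtain ⟨s, t, hst⟩ := exists_endpoints G.edge_two
  obtain ⟨z, hz⟩ := exists_algebraicIndependent_complex (ℕ × Fin 2)
  obtain ⟨σ, hσ⟩ := exists_ringEquiv_of_algebraicIndependent
    ((hxy.algebraicIndependent fun e => (hst e).1).map' (f := MvPolynomial.aeval z) hz)
    hlam.algebraicIndependent_complex
  refine ⟨Quot.mk _ ⟨fun u i => σ (z (u, i)),
    planeInduces_of_endpoints (fun e => (hst e).1) fun e => ?_⟩⟩
  rw [← hσ e]
  simp

theorem exists_rotation {d : Fin 2 → ℂ} (hd : ∑ i, d i ^ 2 ≠ 0) :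
    ∃ A : Matrix (Fin 2) (Fin 2) ℂ, A * A.transpose = 1 ∧ A.det = 1 ∧
      A.transpose.mulVec d 1 = 0 := by
  obtain ⟨c, hc⟩ := IsAlgClosed.exists_pow_nat_eq (∑ i, d i ^ 2) (n := 2) (by norm_num)
  have hc0 : c ≠ 0 := by
    rintro rfl
    exact hd (by simpa using hc.symm)
  rw [Fin.sum_univ_two] at hc
  refine ⟨!![d 0 / c, -d 1 / c; d 1 / c, d 0 / c], ?_, ?_, ?_⟩
  · ext i j
    fin_cases i <;> fin_cases j <;> simp [Matrix.mul_apply, Fin.sum_univ_two] <;> field_simp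
    · rw [hc]
    · ring
    · ring
    · rw [hc]; ring
  · rw [Matrix.det_fin_two_of]
    field_simp
    rw [hc]; ring
  · simp [Matrix.mulVec, dotProduct, Fin.sum_univ_two]
    ring

theorem sum_sq_mulVec {A : Matrix (Fin 2) (Fin 2) ℂ} (hA : A.transpose * A = 1) (w : Fin 2 → ℂ) :
    ∑ i, A.mulVec w i ^ 2 = ∑ i, w i ^ 2 := by
  have h : A.mulVec w ⬝ᵥ A.mulVec w = w ⬝ᵥ w := by
    rw [Matrix.dotProduct_mulVec, Matrix.vecMul_mulVec, hA, Matrix.vecMul_one]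
  simpa [dotProduct, pow_two] using h

theorem Laman.finite_planeClasses {G : GeoGraph} (hG : Laman G) {lam : Finset ℕ → ℝ}
    (hlam : Generic G lam) : Finite (PlaneClasses G lam) := by
  obtain ⟨s, t, hst⟩ := exists_endpoints G.edge_two
  obtain ⟨e₀, he₀⟩ : G.E.Nonempty := by
    rw [← Finset.card_pos, hG.2.1]
    have := hG.1
    omega
  obtain ⟨a, b, hab, rfl⟩ := Finset.card_eq_two.1 (G.edge_two _ he₀)
  have haV : a ∈ G.V := G.edge_sub _ he₀ (by simp)
  have hbV : b ∈ G.V := G.edge_sub _ he₀ (by simp)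
  let I : Finset (ℕ × Fin 2) := (G.V ×ˢ Finset.univ) \ {(a, 0), (a, 1), (b, 1)}
  have hI : I.card = G.E.card := by
    rw [Finset.card_sdiff_of_subset, hG.2.1, Finset.card_product,
      Finset.card_eq_three.2 ⟨_, _, _, by simp, by simp [hab], by simp [hab], rfl⟩]
    · simp [mul_comm]
    · intro p hp
      simp only [Finset.mem_insert, Finset.mem_singleton] at hp
      rcases hp with rfl | rfl | rfl <;> simp [haV, hbV]
  let ext : (I → ℂ) → ℕ → Fin 2 → ℂ := fun z u i => if h : (u, i) ∈ I then z ⟨(u, i), h⟩ else 0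
  let ξ : ℕ → Fin 2 → MvPolynomial I ℚ := fun u i =>
    if h : (u, i) ∈ I then MvPolynomial.X ⟨(u, i), h⟩ else 0
  have hξ (z : I → ℂ) (u : ℕ) (i : Fin 2) : MvPolynomial.aeval z (ξ u i) = ext z u i := by
    simp only [ξ, ext]
    split_ifs <;> simp
  let F : G.E → MvPolynomial I ℚ := fun e => ∑ i, (ξ (s e) i - ξ (t e) i) ^ 2
  have hF (z : I → ℂ) (e : G.E) : MvPolynomial.aeval z (F e) =
      ∑ i, (ext z (s e) i - ext z (t e) i) ^ 2 := by
    simp [F, hξ]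
  have hfin := finite_fiber_of_algebraicIndependent (by simp [hI]) F
    hlam.algebraicIndependent_complex
  have := hfin.to_subtype
  refine Finite.of_surjective (fun z : {z : I → ℂ | ∀ e : G.E, MvPolynomial.aeval z (F e) =
    (lam e : ℂ)} => (Quot.mk _ ⟨ext z, planeInduces_of_endpoints (fun e => (hst e).1)
      fun e => (hF z e).symm.trans (z.2 e)⟩ : PlaneClasses G lam)) ?_
  rintro ⟨ρ, hρ⟩
  obtain ⟨A, hA, hdet, hA0⟩ := exists_rotation (d := fun i => ρ b i - ρ a i) (by
    rw [hρ b a (by rwa [Finset.pair_comm]), Finset.pair_comm]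
    exact_mod_cast (hlam.1 _ he₀).ne')
  let ρ' : ℕ → Fin 2 → ℂ := fun v => A.transpose.mulVec (ρ v - ρ a)
  have hext : ∀ v ∈ G.V, ext (fun p => ρ' p.1.1 p.1.2) v = ρ' v := by
    intro v hv
    ext i
    simp only [ext]
    split_ifs with h
    · rfl
    · have h1 : (v, i) = (a, 0) ∨ (v, i) = (a, 1) ∨ (v, i) = (b, 1) := by
        have h2 : ¬(v = a ∧ i = 0) → ¬(v = a ∧ i = 1) → v = b ∧ i = 1 := by simpa [I, hv] using h
        simp only [Prod.mk.injEq]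
        tauto
      simp only [Prod.mk.injEq] at h1
      rcases h1 with ⟨rfl, rfl⟩ | ⟨rfl, rfl⟩ | ⟨rfl, rfl⟩
      · simp [ρ']
      · simp [ρ']
      · exact hA0.symm
  refine ⟨⟨fun p => ρ' p.1.1 p.1.2, fun e => ?_⟩, Quot.sound ⟨A, ρ a, hA, hdet, fun v hv => ?_⟩⟩
  · have he := e.2
    rw [(hst e).1] at he
    have hs := hext (s e) (G.edge_sub _ he (by simp))
    have ht := hext (t e) (G.edge_sub _ he (by simp))
    rw [hF, hs, ht, (hst e).1, ← hρ _ _ he]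
    have h1 (i : Fin 2) : ρ' (s e) i - ρ' (t e) i =
        A.transpose.mulVec (ρ (s e) - ρ (t e)) i := by
      rw [← Pi.sub_apply, ← Matrix.mulVec_sub, sub_sub_sub_cancel_right]
    simp only [h1]
    rw [sum_sq_mulVec (by simpa using hA)]
    rfl
  · change ρ v = A.mulVec (ext _ v) + ρ a
    rw [hext v hv, Matrix.mulVec_mulVec, hA, Matrix.one_mulVec, sub_add_cancel]

theorem PlaneInduces.map {G : GeoGraph} {ρ : ℕ → Fin 2 → ℂ} {lam lam' : Finset ℕ → ℝ}
    (h : PlaneInduces G ρ lam) (σ : ℂ ≃+* ℂ) (hσ : ∀ e ∈ G.E, σ (lam e) = lam' e) :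
    PlaneInduces G (fun v i => σ (ρ v i)) lam' := by
  intro u v huv
  rw [← hσ _ huv, ← h u v huv]
  simp

theorem PlaneCongruent.map {G : GeoGraph} {ρ ρ' : ℕ → Fin 2 → ℂ} (h : PlaneCongruent G ρ ρ')
    (σ : ℂ ≃+* ℂ) : PlaneCongruent G (fun v i => σ (ρ v i)) (fun v i => σ (ρ' v i)) := by
  obtain ⟨A, b, hA, hdet, h⟩ := h
  refine ⟨A.map σ, fun i => σ (b i), ?_, ?_, fun v hv => ?_⟩
  · have := congrArg (fun M => M.map σ) hA
    simpa [Matrix.map_mul, Matrix.transpose_map] using this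
  · have := congrArg σ hdet
    simpa [Matrix.det_fin_two] using this
  · ext i
    fin_cases i <;> simp [h v hv]

/-- Field automorphisms of `ℂ` identify the congruence classes for conjugate edge lengths. -/
def planeClassesEquiv {G : GeoGraph} {lam lam' : Finset ℕ → ℝ} (σ : ℂ ≃+* ℂ)
    (hσ : ∀ e ∈ G.E, σ (lam e) = lam' e) : PlaneClasses G lam ≃ PlaneClasses G lam' :=
  Quot.congr
    (Equiv.subtypeEquiv
      (Equiv.piCongrRight fun _ => Equiv.piCongrRight fun _ => σ.toEquiv) fun ρ =>
      ⟨fun h => h.map σ hσ, fun h => by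
        simpa using PlaneInduces.map h σ.symm (lam' := lam) fun e he => by simp [← hσ e he]⟩)
    fun ρ ρ' => ⟨fun h => h.map σ, fun h => by simpa using PlaneCongruent.map h σ.symm⟩

/-- For a minimally rigid graph, the number of congruence classes of plane
realizations is the same for all generic edge-length assignments. -/
theorem plane_count_independent_of_generic_lengths (G : GeoGraph) (hG : Laman G)
    (lam lam' : Finset ℕ → ℝ) (hlam : Generic G lam) (hlam' : Generic G lam') :
    Finite (PlaneClasses G lam) ∧ Finite (PlaneClasses G lam') ∧
    Nonempty (PlaneClasses G lam) ∧ Nonempty (PlaneClasses G lam') ∧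
    Nat.card (PlaneClasses G lam) = Nat.card (PlaneClasses G lam') := by
  obtain ⟨σ, hσ⟩ := exists_ringEquiv_of_algebraicIndependent
    hlam.algebraicIndependent_complex hlam'.algebraicIndependent_complex
  exact ⟨hG.finite_planeClasses hlam, hG.finite_planeClasses hlam',
    hG.nonempty_planeClasses hlam, hG.nonempty_planeClasses hlam',
    Nat.card_congr (planeClassesEquiv σ fun e he => hσ ⟨e, he⟩)⟩
end

section
/- Let G be the graph with vertex set {1,2,3,4} and edge set {{1,2},{2,3},{3,4},{4,1},{1,3}} (the complete graph K₄ minus one edge). For every generic edge-length assignment λ : E(G) → ℝ_{>0}, the set of congruence classes of spherical realizations of G inducing λ has exactly 4 elements. -/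
/-- The graph `K₄` minus an edge: vertices `{1,2,3,4}`,
edges `{1,2},{2,3},{3,4},{4,1},{1,3}`. -/
def K4minus : GeoGraph where
  V := {1, 2, 3, 4}
  E := {{1, 2}, {2, 3}, {3, 4}, {4, 1}, {1, 3}}
  edge_sub := by decide
  edge_two := by decide

/-- The matrix with rows `u`, `v`, `u × v`. -/
def crossFrame (u v : Fin 3 → ℂ) : Matrix (Fin 3) (Fin 3) ℂ :=
  Matrix.of ![u, v, crossProduct u v]

/-- The scalar triple product. -/
def tripleProduct (u v w : Fin 3 → ℂ) : ℂ := crossProduct u v ⬝ᵥ w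

theorem tripleProduct_eq_det (u v w : Fin 3 → ℂ) :
    tripleProduct u v w = (Matrix.of ![u, v, w]).det := by
  simp [tripleProduct, cross_apply, Matrix.det_fin_three, dotProduct, Fin.sum_univ_three]
  ring

theorem tripleProduct_mulVec (A : Matrix (Fin 3) (Fin 3) ℂ) (u v w : Fin 3 → ℂ) :
    tripleProduct (A.mulVec u) (A.mulVec v) (A.mulVec w) = A.det * tripleProduct u v w := by
  simp only [tripleProduct_eq_det]
  rw [← Matrix.det_transpose A, mul_comm, ← Matrix.det_mul]
  congr 1
  ext i j
  fin_cases i <;> simp [Matrix.mul_apply, Matrix.mulVec, dotProduct, mul_comm]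

theorem tripleProduct_sq (u v w : Fin 3 → ℂ) (hu : u ⬝ᵥ u = 1) (hv : v ⬝ᵥ v = 1)
    (hw : w ⬝ᵥ w = 1) :
    tripleProduct u v w ^ 2 =
      1 - (u ⬝ᵥ w) ^ 2 - (v ⬝ᵥ w) ^ 2 - (u ⬝ᵥ v) ^ 2
        + 2 * (u ⬝ᵥ w) * (v ⬝ᵥ w) * (u ⬝ᵥ v) := by
  have key : tripleProduct u v w ^ 2 =
      (u ⬝ᵥ u) * (v ⬝ᵥ v) * (w ⬝ᵥ w) - (v ⬝ᵥ v) * (u ⬝ᵥ w) ^ 2 - (u ⬝ᵥ u) * (v ⬝ᵥ w) ^ 2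
        - (w ⬝ᵥ w) * (u ⬝ᵥ v) ^ 2 + 2 * (u ⬝ᵥ w) * (v ⬝ᵥ w) * (u ⬝ᵥ v) := by
    simp [tripleProduct, cross_apply, dotProduct, Fin.sum_univ_three]
    ring
  rw [key, hu, hv, hw]
  ring

theorem crossFrame_mulVec (u v w : Fin 3 → ℂ) :
    (crossFrame u v).mulVec w = ![u ⬝ᵥ w, v ⬝ᵥ w, tripleProduct u v w] := by
  ext i
  fin_cases i <;> rfl

theorem det_crossFrame (u v : Fin 3 → ℂ) :
    (crossFrame u v).det = (u ⬝ᵥ u) * (v ⬝ᵥ v) - (u ⬝ᵥ v) ^ 2 := by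
  simp [crossFrame, cross_apply, Matrix.det_fin_three, Matrix.vec3_dotProduct]
  ring

theorem crossFrame_mul_transpose (u v : Fin 3 → ℂ) :
    crossFrame u v * (crossFrame u v).transpose =
      !![u ⬝ᵥ u, u ⬝ᵥ v, 0; u ⬝ᵥ v, v ⬝ᵥ v, 0;
        0, 0, (u ⬝ᵥ u) * (v ⬝ᵥ v) - (u ⬝ᵥ v) ^ 2] := by
  ext i j
  fin_cases i <;> fin_cases j <;>
    simp [crossFrame, cross_apply, Matrix.mul_apply, Fin.sum_univ_three,
      Matrix.vec3_dotProduct] <;> ring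

/-- Two pairs of vectors with the same nondegenerate Gram matrix are related by a rotation,
which identifies any two vectors with the same coordinates relative to the pairs. -/
theorem exists_rotation_s5 (u v u' v' : Fin 3 → ℂ) (huu : u ⬝ᵥ u = u' ⬝ᵥ u')
    (hvv : v ⬝ᵥ v = v' ⬝ᵥ v') (huv : u ⬝ᵥ v = u' ⬝ᵥ v')
    (hnd : (u ⬝ᵥ u) * (v ⬝ᵥ v) - (u ⬝ᵥ v) ^ 2 ≠ 0) :
    ∃ A : Matrix (Fin 3) (Fin 3) ℂ, A * A.transpose = 1 ∧ A.det = 1 ∧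
      ∀ w w' : Fin 3 → ℂ, u ⬝ᵥ w = u' ⬝ᵥ w' → v ⬝ᵥ w = v' ⬝ᵥ w' →
        tripleProduct u v w = tripleProduct u' v' w' → w' = A.mulVec w := by
  have hdet : (crossFrame u v).det = (crossFrame u' v').det := by
    rw [det_crossFrame, det_crossFrame, huu, hvv, huv]
  have hgram : crossFrame u v * (crossFrame u v).transpose =
      crossFrame u' v' * (crossFrame u' v').transpose := by
    rw [crossFrame_mul_transpose, crossFrame_mul_transpose, huu, hvv, huv]
  rw [← det_crossFrame] at hnd
  have hunit : IsUnit (crossFrame u' v').det := by rw [← hdet]; exact hnd.isUnit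
  have hunit' : IsUnit (crossFrame u' v').transpose.det := by rwa [Matrix.det_transpose]
  refine ⟨(crossFrame u' v')⁻¹ * crossFrame u v, ?_, ?_, ?_⟩
  · rw [Matrix.transpose_mul, Matrix.mul_assoc, ← Matrix.mul_assoc (crossFrame u v), hgram,
      Matrix.mul_assoc, Matrix.transpose_nonsing_inv, Matrix.mul_nonsing_inv _ hunit',
      Matrix.mul_one, Matrix.nonsing_inv_mul _ hunit]
  · rw [Matrix.det_mul, hdet, ← Matrix.det_mul, Matrix.nonsing_inv_mul _ hunit, Matrix.det_one]
  · intro w w' h₁ h₂ h₃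
    have h : (crossFrame u v).mulVec w = (crossFrame u' v').mulVec w' := by
      rw [crossFrame_mulVec, crossFrame_mulVec, h₁, h₂, h₃]
    rw [← Matrix.mulVec_mulVec, h, Matrix.mulVec_mulVec, Matrix.nonsing_inv_mul _ hunit,
      Matrix.one_mulVec]

theorem sum_sq_eq_dotProduct (u : Fin 3 → ℂ) : ∑ i, u i ^ 2 = u ⬝ᵥ u := by
  simp [dotProduct, pow_two]

theorem sum_sub_sq_eq_iff {u v : Fin 3 → ℂ} (hu : u ⬝ᵥ u = 1) (hv : v ⬝ᵥ v = 1) (l : ℂ) :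
    ∑ i, (u i - v i) ^ 2 = l ↔ u ⬝ᵥ v = 1 - l / 2 := by
  have h : ∑ i, (u i - v i) ^ 2 = u ⬝ᵥ u + v ⬝ᵥ v - 2 * (u ⬝ᵥ v) := by
    simp [dotProduct, Fin.sum_univ_three]
    ring
  rw [h, hu, hv]
  constructor <;> intro h
  · linear_combination (-1 / 2) * h
  · linear_combination (-2) * h

/-- The inner product of two points of the sphere at the squared distance `lam e`. -/
noncomputable def edgeDot (lam : Finset ℕ → ℝ) (e : Finset ℕ) : ℂ := 1 - (lam e : ℂ) / 2

/-- The determinant of a `3 × 3` Gram matrix with unit diagonal. -/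
def gramDet (a b c : ℂ) : ℂ := 1 - a ^ 2 - b ^ 2 - c ^ 2 + 2 * a * b * c

theorem k4minus_realization_iff (lam : Finset ℕ → ℝ) (ρ : ℕ → Fin 3 → ℂ) :
    (SphereRealization K4minus ρ ∧ SphereInduces K4minus ρ lam) ↔
      (ρ 1 ⬝ᵥ ρ 1 = 1 ∧ ρ 2 ⬝ᵥ ρ 2 = 1 ∧ ρ 3 ⬝ᵥ ρ 3 = 1 ∧ ρ 4 ⬝ᵥ ρ 4 = 1) ∧
      ρ 1 ⬝ᵥ ρ 3 = edgeDot lam {1, 3} ∧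
      ρ 1 ⬝ᵥ ρ 2 = edgeDot lam {1, 2} ∧ ρ 3 ⬝ᵥ ρ 2 = edgeDot lam {2, 3} ∧
      ρ 1 ⬝ᵥ ρ 4 = edgeDot lam {4, 1} ∧ ρ 3 ⬝ᵥ ρ 4 = edgeDot lam {3, 4} := by
  have hreal : SphereRealization K4minus ρ ↔
      (ρ 1 ⬝ᵥ ρ 1 = 1 ∧ ρ 2 ⬝ᵥ ρ 2 = 1 ∧ ρ 3 ⬝ᵥ ρ 3 = 1 ∧ ρ 4 ⬝ᵥ ρ 4 = 1) := by
    simp [SphereRealization, K4minus, sum_sq_eq_dotProduct]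
  rw [hreal]
  refine and_congr_right ?_
  rintro ⟨h1, h2, h3, h4⟩
  constructor
  · intro h
    refine ⟨(sum_sub_sq_eq_iff h1 h3 _).1 (h 1 3 (by decide)),
      (sum_sub_sq_eq_iff h1 h2 _).1 (h 1 2 (by decide)), ?_, ?_,
      (sum_sub_sq_eq_iff h3 h4 _).1 (h 3 4 (by decide))⟩
    · rw [dotProduct_comm]
      exact (sum_sub_sq_eq_iff h2 h3 _).1 (h 2 3 (by decide))
    · rw [dotProduct_comm]
      exact (sum_sub_sq_eq_iff h4 h1 _).1 (h 4 1 (by decide))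
  · rintro ⟨h13, h12, h32, h14, h34⟩
    have e13 := (sum_sub_sq_eq_iff h1 h3 _).2 h13
    have e12 := (sum_sub_sq_eq_iff h1 h2 _).2 h12
    have e32 := (sum_sub_sq_eq_iff h3 h2 _).2 h32
    have e14 := (sum_sub_sq_eq_iff h1 h4 _).2 h14
    have e34 := (sum_sub_sq_eq_iff h3 h4 _).2 h34
    have swap : ∀ {u v : ℕ} {e : Finset ℕ}, ({u, v} : Finset ℕ) = e →
        ∑ i, (ρ u i - ρ v i) ^ 2 = (lam e : ℂ) →
        ∑ i, (ρ u i - ρ v i) ^ 2 = (lam {u, v} : ℂ) ∧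
        ∑ i, (ρ v i - ρ u i) ^ 2 = (lam {v, u} : ℂ) := by
      intro u v e he h
      subst he
      refine ⟨h, ?_⟩
      rw [Finset.pair_comm, ← h]
      exact Finset.sum_congr rfl fun i _ => by ring
    intro u v huv
    have hu : u ∈ ({1, 2, 3, 4} : Finset ℕ) := K4minus.edge_sub _ huv (by simp)
    have hv : v ∈ ({1, 2, 3, 4} : Finset ℕ) := K4minus.edge_sub _ huv (by simp)
    fin_cases hu <;> fin_cases hv <;>
      first
      | exact absurd huv (by decide)
      | exact (swap (by decide) e13).1
      | exact (swap (by decide) e13).2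
      | exact (swap (by decide) e12).1
      | exact (swap (by decide) e12).2
      | exact (swap (by decide) e32).1
      | exact (swap (by decide) e32).2
      | exact (swap (by decide) e14).1
      | exact (swap (by decide) e14).2
      | exact (swap (by decide) e34).1
      | exact (swap (by decide) e34).2

theorem aeval_ne_zero_of_generic {G : GeoGraph} {lam : Finset ℕ → ℝ} (hlam : Generic G lam)
    (p : MvPolynomial G.E ℚ) (x : G.E → ℚ) (hp : MvPolynomial.eval x p ≠ 0) :
    MvPolynomial.aeval (fun e : G.E => (lam e.1 : ℂ)) p ≠ 0 := by
  have h : AlgebraicIndependent ℚ (fun e : G.E => (lam e.1 : ℂ)) :=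
    hlam.2.map' (f := Complex.ofRealAm.restrictScalars ℚ) Complex.ofReal_injective
  intro h0
  rw [(algebraicIndependent_iff.1 h) p h0] at hp
  simp at hp

theorem gramDet_edgeDot_ne_zero {G : GeoGraph} {lam : Finset ℕ → ℝ} (hlam : Generic G lam)
    {e f g : Finset ℕ} (he : e ∈ G.E) (hf : f ∈ G.E) (hg : g ∈ G.E) :
    gramDet (edgeDot lam e) (edgeDot lam f) (edgeDot lam g) ≠ 0 := by
  let q (e : G.E) : MvPolynomial G.E ℚ := 1 - MvPolynomial.C (1 / 2) * MvPolynomial.X e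
  have h := aeval_ne_zero_of_generic hlam
    (1 - q ⟨e, he⟩ ^ 2 - q ⟨f, hf⟩ ^ 2 - q ⟨g, hg⟩ ^ 2
      + 2 * q ⟨e, he⟩ * q ⟨f, hf⟩ * q ⟨g, hg⟩) (fun _ => 2) (by simp [q])
  convert h using 1
  simp [q, gramDet, edgeDot]
  ring

theorem one_sub_edgeDot_sq_ne_zero {G : GeoGraph} {lam : Finset ℕ → ℝ} (hlam : Generic G lam)
    {e : Finset ℕ} (he : e ∈ G.E) : 1 - edgeDot lam e ^ 2 ≠ 0 := by
  have h := aeval_ne_zero_of_generic hlam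
    (1 - (1 - MvPolynomial.C (1 / 2) * MvPolynomial.X ⟨e, he⟩) ^ 2) (fun _ => 2) (by simp)
  convert h using 1
  simp [edgeDot]
  ring

theorem natCard_sq_eq {g : ℂ} (hg : g ≠ 0) : Nat.card {z : ℂ // z ^ 2 = g} = 2 := by
  obtain ⟨s, rfl⟩ := IsAlgClosed.exists_pow_nat_eq g two_pos
  have hs : s ≠ -s := by
    intro h
    apply hg
    rw [self_eq_neg.1 h]
    simp
  have hset : {z : ℂ | z ^ 2 = s ^ 2} = {s, -s} := by
    ext z
    simp [sq_eq_sq_iff_eq_or_eq_neg]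
  calc Nat.card {z : ℂ // z ^ 2 = s ^ 2} = Set.ncard {z : ℂ | z ^ 2 = s ^ 2} := rfl
    _ = 2 := by rw [hset, Set.ncard_pair hs]

/-- A point of the sphere with prescribed inner products with `(1,0,0)` and `(c,r,0)` and
prescribed triple product `z`. -/
noncomputable def spherePoint (c r a b z : ℂ) : Fin 3 → ℂ := ![a, (b - a * c) / r, z / r]

theorem spherePoint_spec {c r a b z : ℂ} (hr : r ^ 2 = 1 - c ^ 2) (hr0 : r ≠ 0)
    (hz : z ^ 2 = gramDet a b c) :
    spherePoint c r a b z ⬝ᵥ spherePoint c r a b z = 1 ∧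
    ![1, 0, 0] ⬝ᵥ spherePoint c r a b z = a ∧ ![c, r, 0] ⬝ᵥ spherePoint c r a b z = b ∧
    tripleProduct ![1, 0, 0] ![c, r, 0] (spherePoint c r a b z) = z := by
  refine ⟨?_, ?_, ?_, ?_⟩
  · simp [spherePoint]
    field_simp
    rw [gramDet] at hz
    linear_combination hz + (a ^ 2 - 1) * hr
  · simp [spherePoint]
  · simp [spherePoint]
    field_simp
    ring
  · simp [spherePoint, tripleProduct, cross_apply]
    field_simp

/-- The signed volumes of the two triangles, as an invariant of a congruence class. -/
noncomputable def classVolumes (lam : Finset ℕ → ℝ) : SphereClasses K4minus lam →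
    {z : ℂ // z ^ 2 = gramDet (edgeDot lam {1, 2}) (edgeDot lam {2, 3}) (edgeDot lam {1, 3})} ×
    {z : ℂ // z ^ 2 = gramDet (edgeDot lam {4, 1}) (edgeDot lam {3, 4}) (edgeDot lam {1, 3})} :=
  Quot.lift
    (fun ρ =>
      (⟨tripleProduct (ρ.1 1) (ρ.1 3) (ρ.1 2), by
        obtain ⟨⟨h1, h2, h3, -⟩, h13, h12, h32, -⟩ := (k4minus_realization_iff lam ρ.1).1 ρ.2
        rw [tripleProduct_sq _ _ _ h1 h3 h2, h13, h12, h32, gramDet]⟩,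
      ⟨tripleProduct (ρ.1 1) (ρ.1 3) (ρ.1 4), by
        obtain ⟨⟨h1, -, h3, h4⟩, h13, -, -, h14, h34⟩ := (k4minus_realization_iff lam ρ.1).1 ρ.2
        rw [tripleProduct_sq _ _ _ h1 h3 h4, h13, h14, h34, gramDet]⟩))
    (by
      rintro ρ ρ' ⟨A, -, hdet, hA⟩
      have h1 := hA 1 (by decide)
      have h2 := hA 2 (by decide)
      have h3 := hA 3 (by decide)
      have h4 := hA 4 (by decide)
      simp only [h1, h2, h3, h4, tripleProduct_mulVec, hdet, one_mul])

theorem classVolumes_injective {lam : Finset ℕ → ℝ} (hlam : Generic K4minus lam) :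
    Function.Injective (classVolumes lam) := by
  rintro ⟨ρ⟩ ⟨ρ'⟩ h
  simp only [classVolumes, Prod.mk.injEq, Subtype.mk.injEq] at h
  obtain ⟨⟨h1, h2, h3, h4⟩, h13, h12, h32, h14, h34⟩ := (k4minus_realization_iff lam ρ.1).1 ρ.2
  obtain ⟨⟨h1', h2', h3', h4'⟩, h13', h12', h32', h14', h34'⟩ :=
    (k4minus_realization_iff lam ρ'.1).1 ρ'.2
  obtain ⟨A, hA, hdet, hmap⟩ := exists_rotation_s5 (ρ.1 1) (ρ.1 3) (ρ'.1 1) (ρ'.1 3)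
    (h1.trans h1'.symm) (h3.trans h3'.symm) (h13.trans h13'.symm)
    (by
      rw [h1, h3, h13, one_mul]
      exact one_sub_edgeDot_sq_ne_zero hlam (by decide))
  refine Quot.sound ⟨A, hA, hdet, ?_⟩
  intro v hv
  change v ∈ ({1, 2, 3, 4} : Finset ℕ) at hv
  fin_cases hv
  · refine hmap _ _ (h1.trans h1'.symm) ?_ ?_
    · rw [dotProduct_comm, h13, dotProduct_comm, h13']
    · simp [tripleProduct, dotProduct_comm _ (ρ.1 1), dotProduct_comm _ (ρ'.1 1)]
  · exact hmap _ _ (h12.trans h12'.symm) (h32.trans h32'.symm) h.1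
  · refine hmap _ _ (h13.trans h13'.symm) (h3.trans h3'.symm) ?_
    simp [tripleProduct, dotProduct_comm _ (ρ.1 3), dotProduct_comm _ (ρ'.1 3)]
  · exact hmap _ _ (h14.trans h14'.symm) (h34.trans h34'.symm) h.2

theorem classVolumes_surjective {lam : Finset ℕ → ℝ} (hlam : Generic K4minus lam) :
    Function.Surjective (classVolumes lam) := by
  rintro ⟨⟨z, hz⟩, ⟨w, hw⟩⟩
  have hc := one_sub_edgeDot_sq_ne_zero hlam (e := {1, 3}) (by decide)
  obtain ⟨r, hr⟩ := IsAlgClosed.exists_pow_nat_eq (1 - edgeDot lam {1, 3} ^ 2) two_pos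
  have hr0 : r ≠ 0 := by
    rintro rfl
    exact hc (by simpa using hr.symm)
  obtain ⟨hz1, hz2, hz3, hz4⟩ := spherePoint_spec hr hr0 hz
  obtain ⟨hw1, hw2, hw3, hw4⟩ := spherePoint_spec hr hr0 hw
  set c := edgeDot lam {1, 3} with hcdef
  let ρ : ℕ → Fin 3 → ℂ := fun n =>
    if n = 1 then ![1, 0, 0] else if n = 3 then ![c, r, 0]
    else if n = 2 then spherePoint c r (edgeDot lam {1, 2}) (edgeDot lam {2, 3}) z
    else spherePoint c r (edgeDot lam {4, 1}) (edgeDot lam {3, 4}) w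
  have hρ : SphereRealization K4minus ρ ∧ SphereInduces K4minus ρ lam := by
    refine (k4minus_realization_iff lam ρ).2
      ⟨⟨?_, hz1, ?_, hw1⟩, ?_, hz2, hz3, hw2, hw3⟩
    · simp [ρ]
    · simp [ρ]
      linear_combination hr
    · simp [ρ, hcdef]
  exact ⟨Quot.mk _ ⟨ρ, hρ⟩, Prod.ext (Subtype.ext hz4) (Subtype.ext hw4)⟩

/-- `K₄` minus an edge has exactly `4` congruence classes of spherical realizations
for every generic edge-length assignment. -/
theorem sphere_count_K4_minus_edge (lam : Finset ℕ → ℝ) (hlam : Generic K4minus lam) :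
    Finite (SphereClasses K4minus lam) ∧ Nat.card (SphereClasses K4minus lam) = 4 := by
  have hcard : Nat.card (SphereClasses K4minus lam) = 4 := by
    rw [Nat.card_congr (Equiv.ofBijective (classVolumes lam)
      ⟨classVolumes_injective hlam, classVolumes_surjective hlam⟩), Nat.card_prod,
      natCard_sq_eq (gramDet_edgeDot_ne_zero hlam (by decide) (by decide) (by decide)),
      natCard_sq_eq (gramDet_edgeDot_ne_zero hlam (by decide) (by decide) (by decide))]
  exact ⟨Nat.finite_of_card_ne_zero (by rw [hcard]; decide), hcard⟩
end

section
/- Let (x₀, x₁, x₂, y₁, y₂) ∈ ℂ⁵ be a nonzero vector satisfying the four equations x₀ = 0, x₁ + x₂ − y₁ − y₂ = 0, y₁y₂ = 0, and x₁x₂ − y₁y₂ = 0. Then (x₀, x₁, x₂, y₁, y₂) is a nonzero scalar multiple of exactly one of the four vectors (0,0,1,0,1), (0,0,1,1,0), (0,1,0,1,0), (0,1,0,0,1). Consequently, the rational map S₃ ⇢ ℙ¹ given simultaneously by (x₀ : −x₁ − x₂ + y₁ + y₂) and by (−y₁y₂ : x₁x₂ − y₁y₂) is undefined precisely at these four points of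 ℙ⁴. -/
/-- The four base points of the cross-ratio map on the Segre cubic, as vectors
in `ℂ⁵` (coordinates `x₀, x₁, x₂, y₁, y₂`). -/
def segreBaseNodes : Set (Fin 5 → ℂ) :=
  {![0, 0, 1, 0, 1], ![0, 0, 1, 1, 0], ![0, 1, 0, 1, 0], ![0, 1, 0, 0, 1]}

theorem sum_eq_two_of_mem_segreBaseNodes {w : Fin 5 → ℂ} (hw : w ∈ segreBaseNodes) :
    ∑ i, w i = 2 := by
  rcases hw with rfl | rfl | rfl | rfl <;> simp [Fin.sum_univ_five] <;> norm_num

theorem segreBaseNodes_eq_of_smul_eq {w w' : Fin 5 → ℂ} (hw : w ∈ segreBaseNodes)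
    (hw' : w' ∈ segreBaseNodes) {c c' : ℂ} (hc : c ≠ 0) (h : c • w = c' • w') : w = w' := by
  have hsum : c * ∑ i, w i = c' * ∑ i, w' i := by
    simpa [Finset.mul_sum] using congrArg (fun u : Fin 5 → ℂ => ∑ i, u i) h
  rw [sum_eq_two_of_mem_segreBaseNodes hw, sum_eq_two_of_mem_segreBaseNodes hw'] at hsum
  obtain rfl : c = c' := mul_right_cancel₀ two_ne_zero hsum
  exact smul_right_injective _ hc h

theorem exists_segreBaseNodes_smul_eq {v : Fin 5 → ℂ} (hv : v ≠ 0) (h0 : v 0 = 0)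
    (hlin : v 1 + v 2 - v 3 - v 4 = 0) (hy : v 3 * v 4 = 0) (hx : v 1 * v 2 - v 3 * v 4 = 0) :
    ∃ w ∈ segreBaseNodes, ∃ c : ℂ, c ≠ 0 ∧ v = c • w := by
  suffices h : ∃ w ∈ segreBaseNodes, ∃ c : ℂ, v = c • w by
    obtain ⟨w, hw, c, rfl⟩ := h
    exact ⟨w, hw, c, left_ne_zero_of_smul hv, rfl⟩
  rw [hy, sub_zero] at hx
  rcases mul_eq_zero.mp hx with h1 | h2 <;> rcases mul_eq_zero.mp hy with h3 | h4
  · refine ⟨![0, 0, 1, 0, 1], by simp [segreBaseNodes], v 2, ?_⟩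
    ext i; fin_cases i <;> simp <;> grind
  · refine ⟨![0, 0, 1, 1, 0], by simp [segreBaseNodes], v 2, ?_⟩
    ext i; fin_cases i <;> simp <;> grind
  · refine ⟨![0, 1, 0, 0, 1], by simp [segreBaseNodes], v 1, ?_⟩
    ext i; fin_cases i <;> simp <;> grind
  · refine ⟨![0, 1, 0, 1, 0], by simp [segreBaseNodes], v 1, ?_⟩
    ext i; fin_cases i <;> simp <;> grind

/-- A nonzero vector `(x₀, x₁, x₂, y₁, y₂) ∈ ℂ⁵` satisfying `x₀ = 0`,
`x₁ + x₂ - y₁ - y₂ = 0`, `y₁y₂ = 0`, and `x₁x₂ - y₁y₂ = 0` is a nonzero scalar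
multiple of exactly one of the four base points; moreover each of the four base
points satisfies these equations.  Hence the rational map given simultaneously by
`(x₀ : -x₁-x₂+y₁+y₂)` and `(-y₁y₂ : x₁x₂-y₁y₂)` is undefined precisely at these
four points of `ℙ⁴`. -/
theorem cross_ratio_map_base_locus :
    (∀ v : Fin 5 → ℂ, v ≠ 0 →
      v 0 = 0 → v 1 + v 2 - v 3 - v 4 = 0 → v 3 * v 4 = 0 →
      v 1 * v 2 - v 3 * v 4 = 0 →
      ∃! w, w ∈ segreBaseNodes ∧ ∃ c : ℂ, c ≠ 0 ∧ v = c • w) ∧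
    (∀ w ∈ segreBaseNodes,
      w 0 = 0 ∧ w 1 + w 2 - w 3 - w 4 = 0 ∧ w 3 * w 4 = 0 ∧
      w 1 * w 2 - w 3 * w 4 = 0) := by
  refine ⟨fun v hv h0 hlin hy hx => ?_, ?_⟩
  · obtain ⟨w, hw, c, hc, rfl⟩ := exists_segreBaseNodes_smul_eq hv h0 hlin hy hx
    refine ⟨w, ⟨hw, c, hc, rfl⟩, ?_⟩
    rintro w' ⟨hw', c', -, h⟩
    exact (segreBaseNodes_eq_of_smul_eq hw hw' hc h).symm
  · rintro w (rfl | rfl | rfl | rfl) <;> simp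
end
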